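/- arXiv:1606.07014 — 3 statements merged into one kernel-verified Lean document; each statement's English description precedes it below -/
import Mathlib

section
/- The product of the ten even genus-2 theta constants is an odd function of the off-diagonal coordinate: for all τ1, τ2 in the complex upper half-plane and all complex τ12 such that both matrices below lie in the Siegel upper half-space of degree 2, Π_{(μ,ν) even} θ[μ,ν]( (τ1, -τ12; -τ12, τ2) ) = - Π_{(μ,ν) even} θ[μ,ν]( (τ1, τ12; τ12, τ2) ). (Consequently χ10, the square of this product, is even in τ12, so all odd-order Taylor coefficients ξ_m of χ10 in the normal direction along ℍ1 × ℍ1 vanish.) -/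
open Complex Real

/-- The genus-2 theta constant with characteristic `μ = (μ1,μ2)`, `ν = (ν1,ν2)` at the point
`(τ1, τ12; τ12, τ2)` of the Siegel upper half-space of degree 2:
`θ[μ,ν](τ) = Σ_{n∈ℤ²} exp( πi(n+μ)ᵀτ(n+μ) + 2πi(n+μ)ᵀν )`. -/
noncomputable def theta2 (μ1 μ2 ν1 ν2 : ℝ) (τ1 τ12 τ2 : ℂ) : ℂ :=
  ∑' n : ℤ × ℤ, Complex.exp
    (π * I * (((n.1 : ℂ) + μ1) ^ 2 * τ1 + 2 * ((n.1 : ℂ) + μ1) * ((n.2 : ℂ) + μ2) * τ12 +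
        ((n.2 : ℂ) + μ2) ^ 2 * τ2) +
      2 * π * I * (((n.1 : ℂ) + μ1) * ν1 + ((n.2 : ℂ) + μ2) * ν2))

/-- The even characteristics in genus 2, encoded by bits: `(μ,ν) = ((b1/2,b2/2),(c1/2,c2/2))`
with `b1,b2,c1,c2 ∈ {0,1}` is even iff `4(μ1ν1 + μ2ν2) = b1c1 + b2c2` is even.
There are exactly ten of them. -/
def evenChars : Finset ((Fin 2 × Fin 2) × (Fin 2 × Fin 2)) :=
  Finset.univ.filter fun x =>
    Even ((x.1.1 : ℕ) * (x.2.1 : ℕ) + (x.1.2 : ℕ) * (x.2.2 : ℕ))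

/-- Reflecting the first summation index, `n₁ ↦ -n₁ - b1`, shows that `theta2` changes by the
sign `(-1)^(b1*c1)` under `τ12 ↦ -τ12`. -/
theorem theta2_neg (b1 b2 c1 c2 : ℕ) (τ1 τ12 τ2 : ℂ) :
    theta2 ((b1 : ℝ) / 2) ((b2 : ℝ) / 2) ((c1 : ℝ) / 2) ((c2 : ℝ) / 2) τ1 (-τ12) τ2 =
    (((-1 : ℤ) ^ (b1 * c1) : ℤ) : ℂ) *
      theta2 ((b1 : ℝ) / 2) ((b2 : ℝ) / 2) ((c1 : ℝ) / 2) ((c2 : ℝ) / 2) τ1 τ12 τ2 := by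
  unfold theta2
  rw [← tsum_mul_left]
  rw [← (Equiv.prodCongr (Equiv.subLeft (-(b1 : ℤ))) (Equiv.refl ℤ)).tsum_eq]
  refine tsum_congr fun n => ?_
  have hs : (((-1 : ℤ) ^ (b1 * c1) : ℤ) : ℂ) = Complex.exp ((b1 * c1 : ℕ) * (π * I)) := by
    rw [Complex.exp_nat_mul, Complex.exp_pi_mul_I]
    push_cast
    rfl
  rw [hs, ← Complex.exp_add, Complex.exp_eq_exp_iff_exists_int]
  refine ⟨-(n.1 * c1) - b1 * c1, ?_⟩
  simp only [Equiv.prodCongr_apply, Prod.map, Equiv.subLeft_apply, Equiv.refl_apply]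
  push_cast
  ring

/-- The product of the ten even genus-2 theta constants is an odd function of the
off-diagonal coordinate `τ12`; consequently `χ10`, its square, is even in `τ12`. -/
theorem chi5_odd_in_offdiagonal (τ1 τ2 τ12 : ℂ)
    (h : Matrix.PosDef !![τ1.im, τ12.im; τ12.im, τ2.im])
    (h' : Matrix.PosDef !![τ1.im, (-τ12).im; (-τ12).im, τ2.im]) :
    (∏ x ∈ evenChars,
      theta2 (((x.1.1 : ℕ) : ℝ) / 2) (((x.1.2 : ℕ) : ℝ) / 2)
        (((x.2.1 : ℕ) : ℝ) / 2) (((x.2.2 : ℕ) : ℝ) / 2) τ1 (-τ12) τ2) =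
    - ∏ x ∈ evenChars,
      theta2 (((x.1.1 : ℕ) : ℝ) / 2) (((x.1.2 : ℕ) : ℝ) / 2)
        (((x.2.1 : ℕ) : ℝ) / 2) (((x.2.2 : ℕ) : ℝ) / 2) τ1 τ12 τ2 := by
  have hsign : ∏ x ∈ evenChars, ((-1 : ℤ) ^ ((x.1.1 : ℕ) * (x.2.1 : ℕ))) = -1 := by
    decide
  rw [Finset.prod_congr rfl fun x _ => theta2_neg x.1.1 x.1.2 x.2.1 x.2.2 τ1 τ12 τ2,
    Finset.prod_mul_distrib, ← Int.cast_prod, hsign]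
  simp
end

section
/- The first-order Taylor coefficient of the product of the ten even genus-2 theta constants in the normal direction along the diagonal is proportional to δ⊗δ: for all τ1, τ2 in the complex upper half-plane, the derivative with respect to τ12 at τ12 = 0 of τ12 ↦ Π_{(μ,ν) even} θ[μ,ν]( (τ1, τ12; τ12, τ2) ) equals -128*π*i * δ(τ1) * δ(τ2), where δ(τ) = e^{πiτ} * Π_{n≥1} (1 - e^{2πinτ})^{12}. (This expresses the leading term χ5 = -2 δ⊗δ s + … of the Taylor expansion of χ5 along ℍ1 × ℍ1, showing χ5 vanishes to order exactly 1 along the locus 𝔄_{1,1}.) -/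
open Complex Real

/-- `δ(τ) = e^{πiτ} Π_{n≥1} (1 - e^{2πinτ})^{12} = η(τ)^{12}`, the square root of the
discriminant modular form `Δ`, a modular form of weight 6 on `Γ1(2)`. -/
noncomputable def deltaForm (τ : ℂ) : ℂ :=
  Complex.exp (π * I * τ) * ∏' n : ℕ, (1 - Complex.exp (2 * π * I * ((n : ℂ) + 1) * τ)) ^ 12


namespace Chi5

/-- `1/(Q;Q)_m`, extended by zero to negative `m`. -/
noncomputable def rr (Q : ℂ) (m : ℤ) : ℂ :=
  if m < 0 then 0 else (∏ k ∈ Finset.range m.toNat, (1 - Q ^ (k + 1)))⁻¹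

/-- finite `q`-Pochhammer symbol `(Q;Q)_n`. -/
noncomputable def poch (Q : ℂ) (n : ℕ) : ℂ := ∏ k ∈ Finset.range n, (1 - Q ^ (k + 1))

lemma poch_succ (Q : ℂ) (n : ℕ) : poch Q (n + 1) = poch Q n * (1 - Q ^ (n + 1)) := by
  simp [poch, Finset.prod_range_succ]

lemma one_sub_ne {Q : ℂ} (hQ : ‖Q‖ < 1) (n : ℕ) : 1 - Q ^ (n + 1) ≠ 0 := by
  intro h
  have h1 : Q ^ (n + 1) = 1 := by linear_combination -h
  have h2 : ‖Q‖ ^ (n + 1) = 1 := by rw [← norm_pow, h1, norm_one]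
  have h3 : ‖Q‖ ^ (n + 1) < 1 := pow_lt_one₀ (norm_nonneg _) hQ (by omega)
  linarith

lemma one_add_ne {Q : ℂ} (hQ : ‖Q‖ < 1) (n : ℕ) : 1 + Q ^ (n + 1) ≠ 0 := by
  intro h
  have h1 : Q ^ (n + 1) = -1 := by linear_combination h
  have h2 : ‖Q‖ ^ (n + 1) = 1 := by rw [← norm_pow, h1, norm_neg, norm_one]
  have h3 : ‖Q‖ ^ (n + 1) < 1 := pow_lt_one₀ (norm_nonneg _) hQ (by omega)
  linarith

lemma poch_ne {Q : ℂ} (hQ : ‖Q‖ < 1) (n : ℕ) : poch Q n ≠ 0 :=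
  Finset.prod_ne_zero_iff.mpr fun k _ => one_sub_ne hQ k

lemma rr_nat (Q : ℂ) (n : ℕ) : rr Q n = (poch Q n)⁻¹ := by
  simp [rr, poch]

lemma rr_neg (Q : ℂ) {m : ℤ} (h : m < 0) : rr Q m = 0 := by
  simp [rr, h]

lemma rr_rec {Q : ℂ} (hQ : ‖Q‖ < 1) (m : ℤ) : rr Q (m - 1) = (1 - Q ^ m) * rr Q m := by
  rcases lt_trichotomy m 0 with h | h | h
  · rw [rr_neg Q h, rr_neg Q (by omega), mul_zero]
  · subst h; rw [rr_neg Q (by omega)]; simp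
  · obtain ⟨n, rfl⟩ : ∃ n : ℕ, m = (n : ℤ) + 1 := ⟨(m - 1).toNat, by omega⟩
    have e : ((n : ℤ) + 1) = ((n + 1 : ℕ) : ℤ) := by push_cast; rfl
    rw [add_sub_cancel_right, rr_nat, e, rr_nat, zpow_natCast, poch_succ]
    have := one_sub_ne hQ n
    have := poch_ne hQ n
    field_simp

/-- the finite triple product coefficient -/
noncomputable def cc (Q : ℂ) (n : ℕ) (j : ℤ) : ℂ := poch Q (2 * n) * rr Q (n + j) * rr Q (n - j)

lemma cc_rec {Q : ℂ} (hQ : ‖Q‖ < 1) (hQ0 : Q ≠ 0) (n : ℕ) (j : ℤ) :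
    cc Q (n + 1) j = (1 + Q ^ (2 * n + 1)) * cc Q n j
      + Q ^ ((n : ℤ) + 1 - j) * cc Q n (j - 1) + Q ^ ((n : ℤ) + 1 + j) * cc Q n (j + 1) := by
  unfold cc
  have e1 : rr Q ((n : ℤ) + j) = (1 - Q ^ ((n : ℤ) + 1 + j)) * rr Q ((n : ℤ) + 1 + j) := by
    rw [← rr_rec hQ]; congr 1; ring
  have e2 : rr Q ((n : ℤ) - j) = (1 - Q ^ ((n : ℤ) + 1 - j)) * rr Q ((n : ℤ) + 1 - j) := by
    rw [← rr_rec hQ]; congr 1; ring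
  have e3 : rr Q ((n : ℤ) + (j - 1)) = (1 - Q ^ ((n : ℤ) + 1 + j) / Q) * rr Q ((n : ℤ) + j) := by
    rw [div_eq_mul_inv, ← zpow_sub_one₀ hQ0 ((n : ℤ) + 1 + j),
      show (n : ℤ) + 1 + j - 1 = n + j by ring, ← rr_rec hQ]
    congr 1; ring
  have e4 : rr Q ((n : ℤ) - (j + 1)) = (1 - Q ^ ((n : ℤ) + 1 - j) / Q) * rr Q ((n : ℤ) - j) := by
    rw [div_eq_mul_inv, ← zpow_sub_one₀ hQ0 ((n : ℤ) + 1 - j),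
      show (n : ℤ) + 1 - j - 1 = n - j by ring, ← rr_rec hQ]
    congr 1; ring
  have e5 : (n : ℤ) - (j - 1) = n + 1 - j := by ring
  have e6 : (n : ℤ) + (j + 1) = n + 1 + j := by ring
  have e7 : Q ^ (2 * n + 2) = Q ^ ((n : ℤ) + 1 + j) * Q ^ ((n : ℤ) + 1 - j) := by
    rw [← zpow_add₀ hQ0, ← zpow_natCast]; congr 1; push_cast; ring
  have e8 : Q ^ (2 * n + 1) = Q ^ ((n : ℤ) + 1 + j) * Q ^ ((n : ℤ) + 1 - j) / Q := by
    rw [← e7]; field_simp; ring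
  rw [show 2 * (n + 1) = (2 * n + 1) + 1 by ring, poch_succ, poch_succ,
    show 2 * n + 1 + 1 = 2 * n + 2 by ring]
  push_cast
  rw [e3, e4, e1, e2, e5, e6, e7, e8]
  generalize Q ^ ((n : ℤ) + 1 + j) = A
  generalize Q ^ ((n : ℤ) + 1 - j) = B
  field_simp
  ring

/-- the partial product -/
noncomputable def PP (x w : ℂ) (n : ℕ) : ℂ :=
  ∏ k ∈ Finset.range n, ((1 + x ^ (2 * k + 1) * w) * (1 + x ^ (2 * k + 1) * w⁻¹))

noncomputable def tt (x w : ℂ) (j : ℤ) : ℂ := x ^ (j ^ 2) * w ^ j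

lemma tt_up {x w : ℂ} (hx : x ≠ 0) (hw : w ≠ 0) (n : ℕ) (j : ℤ) :
    (x ^ (2 * n + 1) * w) * tt x w (j - 1) = (x ^ 2) ^ ((n : ℤ) + 1 - j) * tt x w j := by
  unfold tt
  have h1 : w ^ j = w * w ^ (j - 1) := by
    rw [← zpow_one_add₀ hw]; congr 1; ring
  have h2 : x ^ (2 * n + 1) * x ^ ((j - 1) ^ 2) = (x ^ 2) ^ ((n : ℤ) + 1 - j) * x ^ (j ^ 2) := by
    rw [← zpow_natCast x (2 * n + 1), ← zpow_natCast x 2, ← zpow_mul, ← zpow_add₀ hx,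
      ← zpow_add₀ hx]
    congr 1; push_cast; ring
  rw [h1]
  linear_combination w * w ^ (j - 1) * h2

lemma tt_down {x w : ℂ} (hx : x ≠ 0) (hw : w ≠ 0) (n : ℕ) (j : ℤ) :
    (x ^ (2 * n + 1) * w⁻¹) * tt x w (j + 1) = (x ^ 2) ^ ((n : ℤ) + 1 + j) * tt x w j := by
  unfold tt
  have h1 : w ^ (j + 1) = w * w ^ j := by
    rw [← zpow_one_add₀ hw]; congr 1; ring
  have h2 : x ^ (2 * n + 1) * x ^ ((j + 1) ^ 2) = (x ^ 2) ^ ((n : ℤ) + 1 + j) * x ^ (j ^ 2) := by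
    rw [← zpow_natCast x (2 * n + 1), ← zpow_natCast x 2, ← zpow_mul, ← zpow_add₀ hx,
      ← zpow_add₀ hx]
    congr 1; push_cast; ring
  rw [h1]
  have h3 : w⁻¹ * w = 1 := inv_mul_cancel₀ hw
  linear_combination w ^ j * h2 + x ^ (2 * n + 1) * x ^ ((j + 1) ^ 2) * w ^ j * h3

lemma cc_zero (Q : ℂ) (j : ℤ) (hj : j ≠ 0) : cc Q 0 j = 0 := by
  unfold cc
  rcases lt_or_gt_of_ne hj with h | h
  · rw [rr_neg Q (m := ((0 : ℕ) : ℤ) + j) (by simpa using h)]; simp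
  · rw [rr_neg Q (m := ((0 : ℕ) : ℤ) - j) (by simpa using h)]; simp

lemma cc_zero_zero (Q : ℂ) : cc Q 0 0 = 1 := by
  simp [cc, rr, poch]

lemma finite_triple {x w : ℂ} (hx : x ≠ 0) (hx1 : ‖x ^ 2‖ < 1) (hw : w ≠ 0) (n : ℕ) :
    HasSum (fun j : ℤ => cc (x ^ 2) n j * tt x w j) (PP x w n) := by
  induction n with
  | zero =>
    have := hasSum_single (f := fun j : ℤ => cc (x ^ 2) 0 j * tt x w j) 0
      (fun j hj => by simp [cc_zero _ j hj])
    simpa [cc_zero_zero, tt, PP] using this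
  | succ n ih =>
    have hu := ((Equiv.subRight (1 : ℤ)).hasSum_iff.mpr ih).mul_left (x ^ (2 * n + 1) * w)
    have hd := ((Equiv.addRight (1 : ℤ)).hasSum_iff.mpr ih).mul_left (x ^ (2 * n + 1) * w⁻¹)
    have h := ((ih.mul_left (1 + (x ^ 2) ^ (2 * n + 1))).add hu).add hd
    have e : PP x w (n + 1) = (1 + (x ^ 2) ^ (2 * n + 1)) * PP x w n
        + x ^ (2 * n + 1) * w * PP x w n + x ^ (2 * n + 1) * w⁻¹ * PP x w n := by
      rw [PP, Finset.prod_range_succ, ← PP, ← pow_mul]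
      field_simp
      ring
    rw [e]
    refine h.congr_fun ?_ |> id
    intro j
    simp only [Function.comp, Equiv.subRight_apply, Equiv.coe_addRight]
    rw [cc_rec hx1 (pow_ne_zero 2 hx)]
    linear_combination (-cc (x ^ 2) n (j - 1)) * tt_up hx hw n j
      - cc (x ^ 2) n (j + 1) * tt_down hx hw n j

/-- logarithmic derivative (times the product) of the partial product -/
noncomputable def DD (x w : ℂ) : ℕ → ℂ
  | 0 => 0
  | n + 1 => (1 + (x ^ 2) ^ (2 * n + 1)) * DD x w n
      + x ^ (2 * n + 1) * w * (DD x w n + PP x w n) + x ^ (2 * n + 1) * w⁻¹ * (DD x w n - PP x w n)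

lemma finite_triple_deriv {x w : ℂ} (hx : x ≠ 0) (hx1 : ‖x ^ 2‖ < 1) (hw : w ≠ 0) (n : ℕ) :
    HasSum (fun j : ℤ => (j : ℂ) * (cc (x ^ 2) n j * tt x w j)) (DD x w n) := by
  induction n with
  | zero =>
    have := hasSum_single (f := fun j : ℤ => (j : ℂ) * (cc (x ^ 2) 0 j * tt x w j)) 0
      (fun j hj => by simp [cc_zero _ j hj])
    simpa [DD] using this
  | succ n ih =>
    have ih0 := finite_triple hx hx1 hw n
    have hu := ((Equiv.subRight (1 : ℤ)).hasSum_iff.mpr (ih.add ih0)).mul_left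
      (x ^ (2 * n + 1) * w)
    have hd := ((Equiv.addRight (1 : ℤ)).hasSum_iff.mpr (ih.sub ih0)).mul_left
      (x ^ (2 * n + 1) * w⁻¹)
    have h := ((ih.mul_left (1 + (x ^ 2) ^ (2 * n + 1))).add hu).add hd
    rw [DD]
    refine h.congr_fun ?_ |> id
    intro j
    simp only [Function.comp, Equiv.subRight_apply, Equiv.coe_addRight]
    rw [cc_rec hx1 (pow_ne_zero 2 hx)]
    push_cast
    linear_combination (-cc (x ^ 2) n (j - 1)) * j * tt_up hx hw n j
      - cc (x ^ 2) n (j + 1) * j * tt_down hx hw n j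

lemma PP_special {x : ℂ} (hx : x ≠ 0) (n : ℕ) : PP x (-x) (n + 1) = 0 := by
  unfold PP
  refine Finset.prod_eq_zero (i := 0) (by simp) ?_
  field_simp
  simp

lemma DD_special {x : ℂ} (hx : x ≠ 0) (n : ℕ) :
    DD x (-x) (n + 1) = poch (x ^ 2) (n + 1) * poch (x ^ 2) n := by
  induction n with
  | zero => simp [DD, PP, poch]; field_simp; ring
  | succ n ih =>
    rw [DD, PP_special hx, ih, poch_succ _ (n + 1)]
    have h := poch_succ (x ^ 2) n
    generalize poch (x ^ 2) (n + 1) = a at *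
    subst h
    simp only [← pow_mul]
    field_simp
    ring

open Filter Topology

noncomputable def LL (Q : ℂ) : ℂ := ∏' n : ℕ, (1 - Q ^ (n + 1))

lemma LL_ne {Q : ℂ} (hQ : ‖Q‖ < 1) : LL Q ≠ 0 := by
  have := tprod_one_add_ne_zero_of_summable (f := fun n : ℕ => -Q ^ (n + 1))
    (fun i => by simpa [sub_eq_add_neg] using one_sub_ne hQ i)
    (by simpa using (summable_nat_add_iff 1).mpr
          (summable_geometric_of_lt_one (norm_nonneg _) hQ))
  simpa [LL, sub_eq_add_neg] using this

lemma poch_tendsto {Q : ℂ} (hQ : ‖Q‖ < 1) : Tendsto (poch Q) atTop (𝓝 (LL Q)) :=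
  (ModularForm.multipliable_one_sub_pow hQ).tendsto_prod_tprod_nat

lemma rr_tendsto {Q : ℂ} (hQ : ‖Q‖ < 1) : Tendsto (rr Q) atTop (𝓝 (LL Q)⁻¹) := by
  have h1 : Tendsto (fun m : ℤ => (poch Q m.toNat)⁻¹) atTop (𝓝 (LL Q)⁻¹) := by
    refine ((poch_tendsto hQ).inv₀ (LL_ne hQ)).comp ?_
    refine tendsto_atTop.2 fun b => ?_
    filter_upwards [eventually_ge_atTop (b : ℤ)] with m hm
    omega
  refine h1.congr' ?_
  filter_upwards [eventually_ge_atTop (0 : ℤ)] with m hm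
  rw [← rr_nat, Int.toNat_of_nonneg hm]

lemma cc_tendsto {Q : ℂ} (hQ : ‖Q‖ < 1) (j : ℤ) :
    Tendsto (fun n => cc Q n j) atTop (𝓝 (LL Q)⁻¹) := by
  have h0 : Tendsto (fun n : ℕ => poch Q (2 * n)) atTop (𝓝 (LL Q)) :=
    (poch_tendsto hQ).comp (tendsto_id.const_mul_atTop' (by norm_num))
  have h1 : Tendsto (fun n : ℕ => rr Q (n + j)) atTop (𝓝 (LL Q)⁻¹) :=
    (rr_tendsto hQ).comp (tendsto_atTop_add_const_right _ j tendsto_natCast_atTop_atTop)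
  have h2 : Tendsto (fun n : ℕ => rr Q (n - j)) atTop (𝓝 (LL Q)⁻¹) :=
    (rr_tendsto hQ).comp (by
      simpa [sub_eq_add_neg] using
        tendsto_atTop_add_const_right _ (-j) (tendsto_natCast_atTop_atTop (R := ℤ)))
  have h := (h0.mul h1).mul h2
  have := LL_ne hQ
  rwa [mul_inv_cancel₀ this, one_mul] at h

lemma cc_bound {Q : ℂ} (hQ : ‖Q‖ < 1) : ∃ C : ℝ, ∀ n j, ‖cc Q n j‖ ≤ C := by
  obtain ⟨A, hA⟩ := (poch_tendsto hQ).norm.bddAbove_range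
  obtain ⟨B, hB⟩ := ((poch_tendsto hQ).inv₀ (LL_ne hQ)).norm.bddAbove_range
  have hA' : ∀ n, ‖poch Q n‖ ≤ A := fun n => hA ⟨n, rfl⟩
  have hB' : ∀ n, ‖(poch Q n)⁻¹‖ ≤ B := fun n => hB ⟨n, rfl⟩
  have hB0 : 0 ≤ B := (norm_nonneg _).trans (hB' 0)
  have hA0 : 0 ≤ A := (norm_nonneg _).trans (hA' 0)
  have hr : ∀ m, ‖rr Q m‖ ≤ B := by
    intro m
    rcases lt_or_ge m 0 with h | h
    · rw [rr_neg Q h]; simpa using hB0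
    · have := hB' m.toNat
      rwa [← rr_nat, Int.toNat_of_nonneg h] at this
  refine ⟨A * B * B, fun n j => ?_⟩
  rw [cc, norm_mul, norm_mul]
  gcongr
  · exact hA' _
  · exact hr _
  · exact hr _

lemma triple_tendsto {x w : ℂ} (hx : x ≠ 0) (hx1 : ‖x ^ 2‖ < 1) (hw : w ≠ 0)
    (hs : Summable (tt x w)) :
    Tendsto (PP x w) atTop (𝓝 ((LL (x ^ 2))⁻¹ * ∑' j, tt x w j)) := by
  obtain ⟨C, hC⟩ := cc_bound hx1
  have := tendsto_tsum_of_dominated_convergence (𝓕 := atTop)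
    (f := fun (n : ℕ) (j : ℤ) => cc (x ^ 2) n j * tt x w j)
    (g := fun j => (LL (x ^ 2))⁻¹ * tt x w j) (hs.norm.mul_left C)
    (fun j => (cc_tendsto hx1 j).mul_const _)
    (Eventually.of_forall fun n j => by rw [norm_mul]; gcongr; exact hC n j)
  simp only [(finite_triple hx hx1 hw _).tsum_eq] at this
  rwa [tsum_mul_left] at this

lemma triple_deriv_tendsto {x w : ℂ} (hx : x ≠ 0) (hx1 : ‖x ^ 2‖ < 1) (hw : w ≠ 0)
    (hs : Summable (fun j : ℤ => (j : ℂ) * tt x w j)) :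
    Tendsto (DD x w) atTop (𝓝 ((LL (x ^ 2))⁻¹ * ∑' j : ℤ, (j : ℂ) * tt x w j)) := by
  obtain ⟨C, hC⟩ := cc_bound hx1
  have := tendsto_tsum_of_dominated_convergence (𝓕 := atTop)
    (f := fun (n : ℕ) (j : ℤ) => (j : ℂ) * (cc (x ^ 2) n j * tt x w j))
    (g := fun j : ℤ => (LL (x ^ 2))⁻¹ * ((j : ℂ) * tt x w j)) (hs.norm.mul_left C)
    (fun j => by
      have := ((cc_tendsto hx1 j).mul_const ((j : ℂ) * tt x w j))
      refine this.congr fun n => by ring)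
    (Eventually.of_forall fun n j => by
      rw [mul_left_comm, norm_mul]; gcongr; exact hC n j)
  simp only [(finite_triple_deriv hx hx1 hw _).tsum_eq] at this
  rwa [tsum_mul_left] at this

lemma theta_deriv_eq {x : ℂ} (hx : x ≠ 0) (hx1 : ‖x ^ 2‖ < 1)
    (hs : Summable (fun j : ℤ => (j : ℂ) * tt x (-x) j)) :
    ∑' j : ℤ, (j : ℂ) * tt x (-x) j = LL (x ^ 2) ^ 3 := by
  have h1 := (triple_deriv_tendsto hx hx1 (neg_ne_zero.2 hx) hs).comp (tendsto_add_atTop_nat 1)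
  have h2 : Tendsto (DD x (-x) ∘ fun n => n + 1) atTop (𝓝 (LL (x ^ 2) * LL (x ^ 2))) := by
    refine (((poch_tendsto hx1).comp (tendsto_add_atTop_nat 1)).mul (poch_tendsto hx1)).congr ?_
    intro n
    simp [DD_special hx]
  have h3 := tendsto_nhds_unique h1 h2
  have := LL_ne hx1
  field_simp at h3
  rw [h3]

lemma theta_odd_zero {x : ℂ} (hx : x ≠ 0) (hx1 : ‖x ^ 2‖ < 1) (hs : Summable (tt x (-x))) :
    ∑' j : ℤ, tt x (-x) j = 0 := by
  have h1 := (triple_tendsto hx hx1 (neg_ne_zero.2 hx) hs).comp (tendsto_add_atTop_nat 1)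
  have h2 : Tendsto (PP x (-x) ∘ fun n => n + 1) atTop (𝓝 0) := by
    refine tendsto_const_nhds.congr ?_
    intro n
    simp [PP_special hx]
  have h3 := tendsto_nhds_unique h1 h2
  have := LL_ne hx1
  simpa [this] using h3

lemma EE_eq (x : ℂ) (n : ℕ) :
    (∏ k ∈ Finset.range n, ((1 + x ^ (2 * k + 1)) * (1 - x ^ (2 * k + 1)) * (1 + x ^ (2 * k + 2))))
      * poch (x ^ 2) n = poch (x ^ 2) (2 * n) := by
  induction n with
  | zero => simp [poch]
  | succ n ih =>
    rw [Finset.prod_range_succ, poch_succ, show 2 * (n + 1) = (2 * n + 1) + 1 by ring,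
      poch_succ, poch_succ, ← ih]
    ring

lemma PPP_eq {x : ℂ} (hx : x ≠ 0) (n : ℕ) :
    PP x 1 n * PP x (-1) n * PP x x n * (1 + x ^ (2 * n)) =
      2 * (∏ k ∈ Finset.range n,
        ((1 + x ^ (2 * k + 1)) * (1 - x ^ (2 * k + 1)) * (1 + x ^ (2 * k + 2)))) ^ 2 := by
  induction n with
  | zero => simp [PP]; norm_num
  | succ n ih =>
    have e : x ^ (2 * n + 1) * x⁻¹ = x ^ (2 * n) := by
      rw [pow_succ]; field_simp
    have step : ∀ w, PP x w (n + 1) =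
        PP x w n * ((1 + x ^ (2 * n + 1) * w) * (1 + x ^ (2 * n + 1) * w⁻¹)) := fun w => by
      simp [PP, Finset.prod_range_succ]
    rw [step, step, step, e, Finset.prod_range_succ, mul_pow, ← mul_assoc 2, ← ih]
    rw [inv_neg, inv_one]
    ring

lemma theta_prod_eq {x : ℂ} (hx : x ≠ 0) (hx1 : ‖x ^ 2‖ < 1) (hs1 : Summable (tt x 1))
    (hs2 : Summable (tt x (-1))) (hs3 : Summable (tt x x)) :
    (∑' j : ℤ, tt x 1 j) * (∑' j : ℤ, tt x (-1) j) * (∑' j : ℤ, tt x x j) =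
      2 * LL (x ^ 2) ^ 3 := by
  have hL := LL_ne hx1
  have h := ((triple_tendsto hx hx1 one_ne_zero hs1).mul
    (triple_tendsto hx hx1 (neg_ne_zero.2 one_ne_zero) hs2)).mul (triple_tendsto hx hx1 hx hs3)
  have hp : Tendsto (fun n : ℕ => 1 + x ^ (2 * n)) atTop (𝓝 (1 + 0)) := by
    refine tendsto_const_nhds.add ?_
    simp only [pow_mul]
    exact tendsto_pow_atTop_nhds_zero_of_norm_lt_one hx1
  have hE : Tendsto (fun n : ℕ => 2 * (poch (x ^ 2) (2 * n) / poch (x ^ 2) n) ^ 2) atTop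
      (𝓝 (2 * (LL (x ^ 2) / LL (x ^ 2)) ^ 2)) := by
    have h0 : Tendsto (fun n : ℕ => poch (x ^ 2) (2 * n)) atTop (𝓝 (LL (x ^ 2))) :=
      (poch_tendsto hx1).comp (tendsto_id.const_mul_atTop' (by norm_num))
    exact ((h0.div (poch_tendsto hx1) hL).pow 2).const_mul 2
  have h3 := tendsto_nhds_unique (h.mul hp) (hE.congr fun n => by
    rw [PPP_eq hx, ← EE_eq, mul_div_cancel_right₀ _ (poch_ne hx1 n)])
  field_simp at h3
  linear_combination h3

/-- one-variable theta term -/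
noncomputable def e1 (μ ν : ℝ) (τ : ℂ) (n : ℤ) : ℂ :=
  cexp (π * I * (((n : ℂ) + μ) ^ 2 * τ) + 2 * π * I * (((n : ℂ) + μ) * ν))

lemma e1_eq (μ ν : ℝ) (τ : ℂ) (n : ℤ) :
    e1 μ ν τ n = cexp (π * I * μ ^ 2 * τ + 2 * π * I * μ * ν) *
      jacobiTheta₂_term n (μ * τ + ν) τ := by
  rw [e1, jacobiTheta₂_term, ← Complex.exp_add]
  congr 1; ring

lemma term_eq (n : ℤ) (z τ : ℂ) :
    jacobiTheta₂_term n z τ = tt (cexp (π * I * τ)) (cexp (2 * π * I * z)) n := by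
  rw [tt, jacobiTheta₂_term, ← Complex.exp_int_mul, ← Complex.exp_int_mul, ← Complex.exp_add]
  congr 1; push_cast; ring

lemma summable_tt {τ : ℂ} (h : 0 < τ.im) (z : ℂ) :
    Summable (tt (cexp (π * I * τ)) (cexp (2 * π * I * z))) := by
  have := (summable_jacobiTheta₂_term_iff z τ).2 h
  simpa only [term_eq] using this

lemma summable_tt' {τ : ℂ} (h : 0 < τ.im) (z : ℂ) :
    Summable (fun j : ℤ => (j : ℂ) * tt (cexp (π * I * τ)) (cexp (2 * π * I * z)) j) := by
  have := (summable_jacobiTheta₂'_term_iff z τ).2 h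
  have h2 := this.mul_left (2 * π * I)⁻¹
  refine h2.congr fun j => ?_
  rw [← term_eq, jacobiTheta₂'_term]
  have : (2 * π * I : ℂ) ≠ 0 := Complex.two_pi_I_ne_zero
  rw [mul_assoc (2 * π * I : ℂ), inv_mul_cancel_left₀ this]

lemma summable_e1 (μ ν : ℝ) {τ : ℂ} (h : 0 < τ.im) : Summable (e1 μ ν τ) := by
  have := ((summable_jacobiTheta₂_term_iff (μ * τ + ν) τ).2 h).mul_left
    (cexp (π * I * μ ^ 2 * τ + 2 * π * I * μ * ν))
  exact this.congr fun n => (e1_eq μ ν τ n).symm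

lemma summable_e1' (μ ν : ℝ) {τ : ℂ} (h : 0 < τ.im) :
    Summable (fun n : ℤ => ((n : ℂ) + μ) * e1 μ ν τ n) := by
  have h1 := (summable_tt' h (μ * τ + ν)).mul_left
    (cexp (π * I * μ ^ 2 * τ + 2 * π * I * μ * ν))
  have h2 := (summable_e1 μ ν h).mul_left (μ : ℂ)
  refine (h1.add h2).congr fun n => ?_
  rw [e1_eq, term_eq]; ring

/-- norm of a one-variable term -/
lemma norm_e1 (μ ν : ℝ) (τ : ℂ) (n : ℤ) :
    ‖e1 μ ν τ n‖ = rexp (-π * ((n : ℝ) + μ) ^ 2 * τ.im) := by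
  rw [e1, Complex.norm_exp]
  congr 1
  have : (π * I * (((n : ℂ) + μ) ^ 2 * τ) + 2 * π * I * (((n : ℂ) + μ) * ν)) =
      ((π * ((n : ℝ) + μ) ^ 2 : ℝ) : ℂ) * (I * τ) + ((2 * π * (((n : ℝ) + μ) * ν) : ℝ) : ℂ) * I := by
    push_cast; ring
  rw [this, Complex.add_re, Complex.re_ofReal_mul, Complex.re_ofReal_mul]
  simp

lemma summable_gauss (μ : ℝ) {y : ℝ} (h : 0 < y) :
    Summable (fun n : ℤ => rexp (-π * ((n : ℝ) + μ) ^ 2 * y)) := by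
  have := (summable_e1 μ 0 (τ := y * I) (by simpa using h)).norm
  refine this.congr fun n => ?_
  rw [norm_e1]; simp

noncomputable def t2 (μ1 μ2 ν1 ν2 : ℝ) (τ1 τ2 : ℂ) (n : ℤ × ℤ) (τ12 : ℂ) : ℂ :=
  cexp (π * I * (((n.1 : ℂ) + μ1) ^ 2 * τ1 + 2 * ((n.1 : ℂ) + μ1) * ((n.2 : ℂ) + μ2) * τ12 +
        ((n.2 : ℂ) + μ2) ^ 2 * τ2) +
      2 * π * I * (((n.1 : ℂ) + μ1) * ν1 + ((n.2 : ℂ) + μ2) * ν2))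

lemma t2_eq (μ1 μ2 ν1 ν2 : ℝ) (τ1 τ2 : ℂ) (n : ℤ × ℤ) (τ12 : ℂ) :
    t2 μ1 μ2 ν1 ν2 τ1 τ2 n τ12 = e1 μ1 ν1 τ1 n.1 * e1 μ2 ν2 τ2 n.2 *
      cexp (2 * π * I * ((n.1 : ℂ) + μ1) * ((n.2 : ℂ) + μ2) * τ12) := by
  rw [t2, e1, e1, ← Complex.exp_add, ← Complex.exp_add]
  congr 1; ring

lemma t2_bound (μ1 μ2 ν1 ν2 : ℝ) (τ1 τ2 : ℂ) {y : ℝ} (hy1 : 2 * y ≤ τ1.im)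
    (hy2 : 2 * y ≤ τ2.im) (n : ℤ × ℤ) {w : ℂ} (hw : ‖w‖ < y) :
    ‖t2 μ1 μ2 ν1 ν2 τ1 τ2 n w‖ ≤
      rexp (-π * ((n.1 : ℝ) + μ1) ^ 2 * y) * rexp (-π * ((n.2 : ℝ) + μ2) ^ 2 * y) := by
  rw [t2_eq, norm_mul, norm_mul, norm_e1, norm_e1, Complex.norm_exp, ← Real.exp_add,
    ← Real.exp_add, ← Real.exp_add]
  apply Real.exp_le_exp.2
  have e : (2 * π * I * ((n.1 : ℂ) + μ1) * ((n.2 : ℂ) + μ2) * w) =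
      ((2 * π * ((n.1 : ℝ) + μ1) * ((n.2 : ℝ) + μ2) : ℝ) : ℂ) * (I * w) := by
    push_cast; ring
  rw [e, Complex.re_ofReal_mul, Complex.I_mul_re]
  generalize (n.1 : ℝ) + μ1 = a
  generalize (n.2 : ℝ) + μ2 = b
  have hi : |w.im| < y := (Complex.abs_im_le_norm w).trans_lt hw
  obtain ⟨hl, hr⟩ := abs_lt.1 hi
  have key : 0 ≤ a ^ 2 * (τ1.im - y) + b ^ 2 * (τ2.im - y) + 2 * a * b * w.im := by
    have h1 : 0 ≤ a ^ 2 * (τ1.im - 2 * y) := mul_nonneg (sq_nonneg a) (by linarith)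
    have h2 : 0 ≤ b ^ 2 * (τ2.im - 2 * y) := mul_nonneg (sq_nonneg b) (by linarith)
    nlinarith [mul_nonneg (sq_nonneg (a + b)) (by linarith : 0 ≤ y + w.im),
      mul_nonneg (sq_nonneg (a - b)) (by linarith : 0 ≤ y - w.im)]
  nlinarith [mul_nonneg Real.pi_pos.le key]

lemma theta2_hasDerivAt (μ1 μ2 ν1 ν2 : ℝ) {τ1 τ2 : ℂ} (h1 : 0 < τ1.im) (h2 : 0 < τ2.im) :
    HasDerivAt (fun τ12 => theta2 μ1 μ2 ν1 ν2 τ1 τ12 τ2)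
      (2 * π * I * (∑' n : ℤ, ((n : ℂ) + μ1) * e1 μ1 ν1 τ1 n) *
        (∑' n : ℤ, ((n : ℂ) + μ2) * e1 μ2 ν2 τ2 n)) 0 := by
  obtain ⟨y, hy, hy1, hy2⟩ : ∃ y : ℝ, 0 < y ∧ 2 * y ≤ τ1.im ∧ 2 * y ≤ τ2.im := by
    refine ⟨min τ1.im τ2.im / 2, by have := lt_min h1 h2; linarith, ?_, ?_⟩
    · have := min_le_left τ1.im τ2.im; linarith
    · have := min_le_right τ1.im τ2.im; linarith
  have hu : Summable (fun n : ℤ × ℤ =>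
      rexp (-π * ((n.1 : ℝ) + μ1) ^ 2 * y) * rexp (-π * ((n.2 : ℝ) + μ2) ^ 2 * y)) :=
    (summable_gauss μ1 hy).mul_of_nonneg (summable_gauss μ2 hy)
      (fun _ => (Real.exp_pos _).le) (fun _ => (Real.exp_pos _).le)
  have hd : ∀ n w, HasDerivAt (t2 μ1 μ2 ν1 ν2 τ1 τ2 n)
      (t2 μ1 μ2 ν1 ν2 τ1 τ2 n w * (2 * π * I * ((n.1 : ℂ) + μ1) * ((n.2 : ℂ) + μ2))) w := by
    intro n w
    have e : t2 μ1 μ2 ν1 ν2 τ1 τ2 n = fun τ12 => e1 μ1 ν1 τ1 n.1 * e1 μ2 ν2 τ2 n.2 *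
      cexp (2 * π * I * ((n.1 : ℂ) + μ1) * ((n.2 : ℂ) + μ2) * τ12) := by
      funext t; exact t2_eq ..
    rw [e]
    have := ((hasDerivAt_id w).const_mul
      (2 * π * I * ((n.1 : ℂ) + μ1) * ((n.2 : ℂ) + μ2))).cexp.const_mul
      (e1 μ1 ν1 τ1 n.1 * e1 μ2 ν2 τ2 n.2)
    refine this.congr_deriv ?_
    simp only [id, mul_one]
    ring
  have hf : ∀ n, DifferentiableOn ℂ (t2 μ1 μ2 ν1 ν2 τ1 τ2 n) (Metric.ball 0 y) :=
    fun n w _ => (hd n w).differentiableAt.differentiableWithinAt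
  have hb : ∀ n w, w ∈ Metric.ball (0 : ℂ) y → ‖t2 μ1 μ2 ν1 ν2 τ1 τ2 n w‖ ≤
      rexp (-π * ((n.1 : ℝ) + μ1) ^ 2 * y) * rexp (-π * ((n.2 : ℝ) + μ2) ^ 2 * y) :=
    fun n w hw => t2_bound μ1 μ2 ν1 ν2 τ1 τ2 hy1 hy2 n (by simpa using hw)
  have h0 : (0 : ℂ) ∈ Metric.ball (0 : ℂ) y := Metric.mem_ball_self hy
  have H := Complex.hasSum_deriv_of_summable_norm hu hf Metric.isOpen_ball hb h0
  have D := ((Complex.differentiableOn_tsum_of_summable_norm hu hf Metric.isOpen_ball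
    hb).differentiableAt (Metric.isOpen_ball.mem_nhds h0)).hasDerivAt
  rw [← H.tsum_eq] at D
  refine HasDerivAt.congr_deriv (f := fun τ12 => theta2 μ1 μ2 ν1 ν2 τ1 τ12 τ2) D ?_
  symm
  rw [mul_assoc, tsum_mul_tsum_of_summable_norm (summable_e1' μ1 ν1 h1).norm
    (summable_e1' μ2 ν2 h2).norm, ← tsum_mul_left]
  refine tsum_congr fun n => ?_
  rw [(hd n 0).deriv, t2_eq]
  simp only [mul_zero, Complex.exp_zero]
  ring

lemma theta2_zero (μ1 μ2 ν1 ν2 : ℝ) {τ1 τ2 : ℂ} (h1 : 0 < τ1.im) (h2 : 0 < τ2.im) :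
    theta2 μ1 μ2 ν1 ν2 τ1 0 τ2 = (∑' n, e1 μ1 ν1 τ1 n) * (∑' n, e1 μ2 ν2 τ2 n) := by
  rw [tsum_mul_tsum_of_summable_norm (summable_e1 μ1 ν1 h1).norm (summable_e1 μ2 ν2 h2).norm]
  refine tsum_congr fun n => ?_
  have := t2_eq μ1 μ2 ν1 ν2 τ1 τ2 n 0
  rw [mul_zero, Complex.exp_zero, mul_one] at this
  rw [← this, t2]

lemma norm_x {τ : ℂ} (h : 0 < τ.im) : ‖cexp (π * I * τ) ^ 2‖ < 1 := by
  rw [← Complex.exp_nat_mul, Complex.norm_exp, Real.exp_lt_one_iff]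
  have : ((2 : ℕ) * (π * I * τ) : ℂ) = ((2 * π : ℝ) : ℂ) * (I * τ) := by push_cast; ring
  rw [this, Complex.re_ofReal_mul, Complex.I_mul_re]
  have := mul_pos Real.pi_pos h
  nlinarith

lemma deltaForm_eq {τ : ℂ} (h : 0 < τ.im) :
    deltaForm τ = cexp (π * I * τ) * LL (cexp (π * I * τ) ^ 2) ^ 12 := by
  rw [deltaForm, LL, ← (ModularForm.multipliable_one_sub_pow (norm_x h)).tprod_pow]
  congr 1
  refine tprod_congr fun n => ?_
  rw [← pow_mul, ← Complex.exp_nat_mul]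
  congr 3
  push_cast; ring

/-- one-variable theta constant -/
noncomputable def th (μ ν : ℝ) (τ : ℂ) : ℂ := ∑' n, e1 μ ν τ n

lemma th_eq (μ ν : ℝ) (τ : ℂ) : th μ ν τ = cexp (π * I * μ ^ 2 * τ + 2 * π * I * μ * ν) *
    ∑' n, tt (cexp (π * I * τ)) (cexp (2 * π * I * (μ * τ + ν))) n := by
  simp only [th, e1_eq, tsum_mul_left, term_eq]

lemma w_half (τ : ℂ) : cexp (2 * π * I * (((1 / 2 : ℝ) : ℂ) * τ + ((0 : ℝ) : ℂ)))
    = cexp (π * I * τ) := by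
  congr 1; push_cast; ring

lemma w_neg (τ : ℂ) : cexp (2 * π * I * (((0 : ℝ) : ℂ) * τ + ((1 / 2 : ℝ) : ℂ))) = -1 := by
  rw [← Complex.exp_pi_mul_I]
  congr 1; push_cast; ring

lemma w_one (τ : ℂ) : cexp (2 * π * I * (((0 : ℝ) : ℂ) * τ + ((0 : ℝ) : ℂ))) = 1 := by
  simp

lemma w_odd (τ : ℂ) : cexp (2 * π * I * (((1 / 2 : ℝ) : ℂ) * τ + ((1 / 2 : ℝ) : ℂ)))
    = -cexp (π * I * τ) := by
  rw [show (2 * π * I * (((1 / 2 : ℝ) : ℂ) * τ + ((1 / 2 : ℝ) : ℂ))) = π * I + π * I * τ by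
    push_cast; ring, Complex.exp_add, Complex.exp_pi_mul_I]
  ring

lemma th_prod {τ : ℂ} (h : 0 < τ.im) :
    th 0 0 τ * th 0 (1 / 2) τ * th (1 / 2) 0 τ =
      2 * cexp (π * I * τ / 4) * LL (cexp (π * I * τ) ^ 2) ^ 3 := by
  have s1 := summable_tt h (((0 : ℝ) : ℂ) * τ + ((0 : ℝ) : ℂ))
  have s2 := summable_tt h (((0 : ℝ) : ℂ) * τ + ((1 / 2 : ℝ) : ℂ))
  have s3 := summable_tt h (((1 / 2 : ℝ) : ℂ) * τ + ((0 : ℝ) : ℂ))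
  rw [w_one] at s1
  rw [w_neg] at s2
  rw [w_half] at s3
  have key := theta_prod_eq (Complex.exp_ne_zero _) (norm_x h) s1 s2 s3
  have a1 : cexp (π * I * ((0 : ℝ) : ℂ) ^ 2 * τ + 2 * π * I * ((0 : ℝ) : ℂ) * ((0 : ℝ) : ℂ)) = 1 := by
    simp
  have a2 : cexp (π * I * ((0 : ℝ) : ℂ) ^ 2 * τ + 2 * π * I * ((0 : ℝ) : ℂ) * ((1 / 2 : ℝ) : ℂ)) = 1 := by
    simp
  have a3 : cexp (π * I * ((1 / 2 : ℝ) : ℂ) ^ 2 * τ + 2 * π * I * ((1 / 2 : ℝ) : ℂ) * ((0 : ℝ) : ℂ))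
      = cexp (π * I * τ / 4) := by
    congr 1; push_cast; ring
  rw [th_eq, th_eq, th_eq, w_one, w_neg, w_half, a1, a2, a3]
  linear_combination cexp (π * I * τ / 4) * key

lemma th_odd {τ : ℂ} (h : 0 < τ.im) : th (1 / 2) (1 / 2) τ = 0 := by
  have s := summable_tt h (((1 / 2 : ℝ) : ℂ) * τ + ((1 / 2 : ℝ) : ℂ))
  rw [w_odd] at s
  rw [th_eq, w_odd, theta_odd_zero (Complex.exp_ne_zero _) (norm_x h) s, mul_zero]

lemma dth_odd {τ : ℂ} (h : 0 < τ.im) :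
    ∑' n : ℤ, ((n : ℂ) + ((1 / 2 : ℝ) : ℂ)) * e1 (1 / 2) (1 / 2) τ n =
      I * cexp (π * I * τ / 4) * LL (cexp (π * I * τ) ^ 2) ^ 3 := by
  have s := summable_tt' h (((1 / 2 : ℝ) : ℂ) * τ + ((1 / 2 : ℝ) : ℂ))
  rw [w_odd] at s
  have key := theta_deriv_eq (Complex.exp_ne_zero _) (norm_x h) s
  have a : cexp (π * I * ((1 / 2 : ℝ) : ℂ) ^ 2 * τ +
      2 * π * I * ((1 / 2 : ℝ) : ℂ) * ((1 / 2 : ℝ) : ℂ)) = I * cexp (π * I * τ / 4) := by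
    rw [show (π * I * ((1 / 2 : ℝ) : ℂ) ^ 2 * τ +
      2 * π * I * ((1 / 2 : ℝ) : ℂ) * ((1 / 2 : ℝ) : ℂ)) = π / 2 * I + π * I * τ / 4 by
        push_cast; ring, Complex.exp_add, Complex.exp_pi_div_two_mul_I]
  have e : ∀ n : ℤ, ((n : ℂ) + ((1 / 2 : ℝ) : ℂ)) * e1 (1 / 2) (1 / 2) τ n =
      I * cexp (π * I * τ / 4) * ((n : ℂ) * tt (cexp (π * I * τ)) (-cexp (π * I * τ)) n) +
        ((1 / 2 : ℝ) : ℂ) * e1 (1 / 2) (1 / 2) τ n := by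
    intro n
    rw [add_mul]
    congr 1
    rw [e1_eq, term_eq, w_odd, a]
    ring
  have h0 := th_odd h
  rw [th] at h0
  rw [tsum_congr e, (s.mul_left _).tsum_add ((summable_e1 _ _ h).mul_left _), tsum_mul_left,
    tsum_mul_left, h0, key]
  ring

/-- the nine even characteristics which are even in both components -/
def evenNine : Finset ((Fin 2 × Fin 2) × (Fin 2 × Fin 2)) :=
  {((0, 0), (0, 0)), ((0, 0), (0, 1)), ((0, 0), (1, 0)),
    ((0, 0), (1, 1)), ((0, 1), (0, 0)), ((0, 1), (1, 0)), ((1, 0), (0, 0)), ((1, 0), (0, 1)),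
    ((1, 1), (0, 0))}

lemma evenChars_eq : evenChars = insert ((1, 1), (1, 1)) evenNine := by
  decide

lemma evenNine_prod {τ1 τ2 : ℂ} (h1 : 0 < τ1.im) (h2 : 0 < τ2.im) :
    ∏ x ∈ evenNine,
        theta2 (((x.1.1 : ℕ) : ℝ) / 2) (((x.1.2 : ℕ) : ℝ) / 2)
          (((x.2.1 : ℕ) : ℝ) / 2) (((x.2.2 : ℕ) : ℝ) / 2) τ1 0 τ2 =
      (th 0 0 τ1 * th 0 (1 / 2) τ1 * th (1 / 2) 0 τ1) ^ 3 *
        (th 0 0 τ2 * th 0 (1 / 2) τ2 * th (1 / 2) 0 τ2) ^ 3 := by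
  simp only [theta2_zero _ _ _ _ h1 h2]
  rw [evenNine]
  repeat rw [Finset.prod_insert (by decide)]
  rw [Finset.prod_singleton]
  simp only [Fin.val_zero, Fin.val_one, Nat.cast_zero, Nat.cast_one, zero_div, th]
  ring

end Chi5

/-- The first-order Taylor coefficient of the product of the ten even genus-2 theta constants
in the normal direction along the diagonal is `-128πi · δ(τ1)δ(τ2)`: the Siegel cusp form `χ5`
vanishes to order exactly 1 along the locus `𝔄_{1,1}`. -/
theorem chi5_first_taylor_coefficient (τ1 τ2 : ℂ) (h1 : 0 < τ1.im) (h2 : 0 < τ2.im) :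
    deriv (fun τ12 : ℂ => ∏ x ∈ evenChars,
        theta2 (((x.1.1 : ℕ) : ℝ) / 2) (((x.1.2 : ℕ) : ℝ) / 2)
          (((x.2.1 : ℕ) : ℝ) / 2) (((x.2.2 : ℕ) : ℝ) / 2) τ1 τ12 τ2) 0 =
      -128 * π * I * deltaForm τ1 * deltaForm τ2 := by
  have hmem : (((1, 1), (1, 1)) : (Fin 2 × Fin 2) × (Fin 2 × Fin 2)) ∈ Chi5.evenNine → False := by
    decide
  have hsplit : (fun τ12 : ℂ => ∏ x ∈ evenChars,
        theta2 (((x.1.1 : ℕ) : ℝ) / 2) (((x.1.2 : ℕ) : ℝ) / 2)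
          (((x.2.1 : ℕ) : ℝ) / 2) (((x.2.2 : ℕ) : ℝ) / 2) τ1 τ12 τ2) =
      fun τ12 : ℂ => (∏ x ∈ Chi5.evenNine,
        theta2 (((x.1.1 : ℕ) : ℝ) / 2) (((x.1.2 : ℕ) : ℝ) / 2)
          (((x.2.1 : ℕ) : ℝ) / 2) (((x.2.2 : ℕ) : ℝ) / 2) τ1 τ12 τ2) *
        theta2 (1 / 2) (1 / 2) (1 / 2) (1 / 2) τ1 τ12 τ2 := by
    funext t
    rw [Chi5.evenChars_eq, Finset.prod_insert hmem, mul_comm]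
    simp
  have hD := Chi5.theta2_hasDerivAt (1 / 2) (1 / 2) (1 / 2) (1 / 2) h1 h2
  have hg : DifferentiableAt ℂ (fun τ12 : ℂ => ∏ x ∈ Chi5.evenNine,
        theta2 (((x.1.1 : ℕ) : ℝ) / 2) (((x.1.2 : ℕ) : ℝ) / 2)
          (((x.2.1 : ℕ) : ℝ) / 2) (((x.2.2 : ℕ) : ℝ) / 2) τ1 τ12 τ2) 0 :=
    DifferentiableAt.fun_finsetProd fun x _ =>
      (Chi5.theta2_hasDerivAt _ _ _ _ h1 h2).differentiableAt
  rw [hsplit, (hg.hasDerivAt.fun_mul hD).deriv, Chi5.theta2_zero _ _ _ _ h1 h2]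
  have ho := Chi5.th_odd h1
  rw [Chi5.th] at ho
  rw [ho, zero_mul, mul_zero, zero_add, Chi5.dth_odd h1, Chi5.dth_odd h2,
    Chi5.evenNine_prod h1 h2, Chi5.th_prod h1, Chi5.th_prod h2, Chi5.deltaForm_eq h1,
    Chi5.deltaForm_eq h2]
  have q1 : ∀ τ : ℂ, cexp (π * I * τ) = cexp (π * I * τ / 4) ^ 4 := fun τ => by
    rw [← Complex.exp_nat_mul]; congr 1; push_cast; ring
  generalize Chi5.LL (cexp (π * I * τ1) ^ 2) = A
  generalize Chi5.LL (cexp (π * I * τ2) ^ 2) = B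
  rw [q1 τ1, q1 τ2]
  generalize cexp (π * I * τ1 / 4) = u
  generalize cexp (π * I * τ2 / 4) = v
  linear_combination 128 * π * I * u ^ 4 * v ^ 4 * A ^ 12 * B ^ 12 * Complex.I_sq
end

section
/- Let K = ℚ(α) be the number field of degree 3 obtained by adjoining a root α of the irreducible polynomial x³ - 1042*x² + 215915*x + 6800500. Then the discriminant of K (the discriminant of its ring of integers) equals 43803704. -/
open Polynomial Module NumberField in
theorem cubic_minpoly_aux (K : Type*) [Field K] [NumberField K] (α : K)
    (hroot : α ^ 3 - 1042 * α ^ 2 + 215915 * α + 6800500 = 0) :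
    (minpoly ℚ α).natDegree = 3 := by
  let p : ℤ[X] := X ^ 3 - 1042 * X ^ 2 + 215915 * X + 6800500
  have hp : p = X ^ 3 - C 1042 * X ^ 2 + C 215915 * X + C 6800500 := rfl
  have hpm : p.Monic := by rw [hp]; monicity!
  have hpd : p.natDegree = 3 := by rw [hp]; compute_degree!
  have hqm : (p.map (algebraMap ℤ ℚ)).Monic := hpm.map _
  have hqd : (p.map (algebraMap ℤ ℚ)).natDegree = 3 := by
    rw [hpm.natDegree_map, hpd]
  have hirr : Irreducible (p.map (algebraMap ℤ ℚ)) := by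
    rw [hqm.irreducible_iff_roots_eq_zero_of_degree_le_three (by omega) (by omega)]
    rw [Multiset.eq_zero_iff_forall_notMem]
    intro r hr
    rw [mem_roots hqm.ne_zero, IsRoot, eval_map, ← aeval_def] at hr
    obtain ⟨z, rfl⟩ := isInteger_of_is_root_of_monic hpm hr
    have h1 : p.eval z = 0 := by
      rw [aeval_algebraMap_apply] at hr
      simpa using hr
    rw [hp] at h1
    simp only [eval_add, eval_sub, eval_mul, eval_pow, eval_X, eval_C] at h1
    have h2 : ((z : ZMod 13)) ^ 3 - 1042 * (z : ZMod 13) ^ 2 + 215915 * (z : ZMod 13)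
        + 6800500 = 0 := by
      have := congrArg (Int.cast : ℤ → ZMod 13) h1
      push_cast at this
      exact this
    generalize (z : ZMod 13) = w at h2
    revert w
    decide
  have hm : p.map (algebraMap ℤ ℚ) = minpoly ℚ α := by
    apply minpoly.eq_of_irreducible_of_monic hirr _ hqm
    rw [aeval_map_algebraMap, hp]
    simp only [map_add, map_sub, map_mul, map_pow, aeval_X, aeval_C]
    simpa using hroot
  rw [← hm, hqd]

open Module NumberField in
theorem cubic_basis_aux (K : Type*) [Field K] [NumberField K] (α : K)
    (hroot : α ^ 3 - 1042 * α ^ 2 + 215915 * α + 6800500 = 0)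
    (hgen : Algebra.adjoin ℚ {α} = ⊤) :
    ∃ b : Basis (Fin 3) ℚ K, ∀ i, b i = α ^ (i : ℕ) := by
  have hint : IsIntegral ℚ α := Algebra.IsIntegral.isIntegral α
  let pb := PowerBasis.ofAdjoinEqTop hint hgen
  have hd : pb.dim = 3 := by
    rw [PowerBasis.ofAdjoinEqTop_dim, cubic_minpoly_aux K α hroot]
  refine ⟨pb.basis.reindex (finCongr hd), fun i => ?_⟩
  rw [Basis.reindex_apply, PowerBasis.basis_eq_pow]
  have hg : pb.gen = α := PowerBasis.ofAdjoinEqTop_gen hint hgen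
  rw [hg]
  rfl

open Module NumberField in
theorem cubic_trace_aux (K : Type*) [Field K] [NumberField K] (α : K)
    (hroot : α ^ 3 - 1042 * α ^ 2 + 215915 * α + 6800500 = 0)
    (b : Basis (Fin 3) ℚ K) (hb : ∀ i, b i = α ^ (i : ℕ)) :
    Algebra.trace ℚ K 1 = 3 ∧ Algebra.trace ℚ K α = 1042 ∧
      Algebra.trace ℚ K (α ^ 2) = 653934 := by
  have hM : Algebra.leftMulMatrix b α = !![0, 0, -6800500; 1, 0, -215915; 0, 1, 1042] := by
    have e0 : α * b 0 = b 1 := by simp [hb]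
    have e1 : α * b 1 = b 2 := by simp [hb]; ring
    have e2 : α * b 2 = (-6800500 : ℚ) • b 0 + (-215915 : ℚ) • b 1 + (1042 : ℚ) • b 2 := by
      simp only [hb, Algebra.smul_def]
      simp
      linear_combination hroot
    ext i j
    rw [Algebra.leftMulMatrix_eq_repr_mul]
    fin_cases j
    · simp only [Fin.zero_eta, e0]
      fin_cases i <;> simp
    · simp only [Fin.mk_one, e1]
      fin_cases i <;> simp
    · simp only [Fin.reduceFinMk, e2]
      fin_cases i <;> simp
  refine ⟨?_, ?_, ?_⟩
  · rw [Algebra.trace_eq_matrix_trace b, map_one]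
    simp
  · rw [Algebra.trace_eq_matrix_trace b, hM]
    simp [Matrix.trace_fin_three]
  · rw [Algebra.trace_eq_matrix_trace b, map_pow, hM, pow_two]
    simp [Matrix.trace_fin_three]
    norm_num

open Module NumberField in
theorem trace_sq_aux (R : Type*) [CommRing R] (b : Basis (Fin 3) ℤ R) (x : R) :
    ∃ s : ℤ, Algebra.trace ℤ R x ^ 2 - Algebra.trace ℤ R (x * x) = 2 * s := by
  rw [Algebra.trace_eq_matrix_trace b, Algebra.trace_eq_matrix_trace b, map_mul]
  set M := Algebra.leftMulMatrix b x
  refine ⟨M 0 0 * M 1 1 - M 0 1 * M 1 0 + M 0 0 * M 2 2 - M 0 2 * M 2 0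
    + M 1 1 * M 2 2 - M 1 2 * M 2 1, ?_⟩
  simp only [Matrix.trace_fin_three, Matrix.mul_apply, Fin.sum_univ_three]
  ring

theorem sq_dvd_aux (m d : ℤ) (h : m ^ 2 * d = 43803704) :
    (m ^ 2 = 1) ∨ (2 ∣ m) := by
  by_cases h2 : (2 : ℤ) ∣ m
  · exact Or.inr h2
  left
  have hsq : Squarefree (10950926 : ℕ) := by
    have h1 : Squarefree 2 := Nat.prime_two.prime.squarefree
    have h2 : Squarefree 7 := (by norm_num : Nat.Prime 7).prime.squarefree
    have h3 : Squarefree 782209 := (by norm_num : Nat.Prime 782209).prime.squarefree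
    have h4 : Squarefree (2 * 7) := (Nat.squarefree_mul (by norm_num)).mpr ⟨h1, h2⟩
    exact (Nat.squarefree_mul (m := 2 * 7) (n := 782209) (by norm_num)).mpr ⟨h4, h3⟩
  have hodd : Odd m := by rwa [← Int.not_even_iff_odd, even_iff_two_dvd]
  have hc : IsCoprime (m ^ 2) (4 : ℤ) := by
    have h0 : IsCoprime m 2 := Int.isCoprime_two_right.mpr hodd
    have := h0.pow (m := 2) (n := 2)
    norm_num at this
    exact_mod_cast this
  have hd : m ^ 2 ∣ 10950926 := by
    apply hc.dvd_of_dvd_mul_left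
    exact ⟨d, by linarith⟩
  have hu : IsUnit m.natAbs := by
    apply hsq
    rw [← Int.natCast_dvd_natCast]
    push_cast
    rw [← sq, sq_abs]
    exact hd
  have := Nat.isUnit_iff.mp hu
  rw [← sq_abs, Int.abs_eq_natAbs, this]
  norm_num

open Module NumberField in
/-- Let `K = ℚ(α)` be the number field obtained by adjoining a root `α` of the irreducible
polynomial `x³ - 1042x² + 215915x + 6800500`. Then the discriminant of `K` equals `43803704`. -/
theorem discr_of_cubic_field (K : Type*) [Field K] [NumberField K] (α : K)
    (hroot : α ^ 3 - 1042 * α ^ 2 + 215915 * α + 6800500 = 0)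
    (hgen : Algebra.adjoin ℚ {α} = ⊤) :
    NumberField.discr K = 43803704 := by
  obtain ⟨b, hb⟩ := cubic_basis_aux K α hroot hgen
  obtain ⟨t0, t1, t2⟩ := cubic_trace_aux K α hroot b hb
  have hα : IsIntegral ℤ α := by
    refine ⟨.X ^ 3 - .C 1042 * .X ^ 2 + .C 215915 * .X + .C 6800500, by monicity!, ?_⟩
    simpa using hroot
  obtain ⟨θ, hθ⟩ : ∃ θ : K, θ = (α ^ 2 - 7227 * α - 1750) / 16785 := ⟨_, rfl⟩
  have h0 : 16785 * θ = α ^ 2 - 7227 * α - 1750 := by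
    rw [hθ]
    field_simp
  have m1 : α * θ = -1050 - 2676 * α - 6185 * θ := by
    have h : (16785 : K) ≠ 0 := by norm_num
    apply mul_left_cancel₀ h
    linear_combination (α + 6185) * h0 + hroot
  have m2 : θ * θ = 560 + 986 * α + 2266 * θ := by
    have h : (16785 : K) ≠ 0 := by norm_num
    apply mul_left_cancel₀ h
    linear_combination (θ + 2676) * h0 + (α - 7227 - 6185) * m1
  have hθi : IsIntegral ℤ θ := by
    refine ⟨.X ^ 3 + .C 410 * .X ^ 2 + .C 34034 * .X - .C 463260, by monicity!, ?_⟩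
    simp
    linear_combination (θ + 2676) * m2 + 986 * m1
  have t3 : Algebra.trace ℚ K θ = -410 := by
    have h := congrArg (Algebra.trace ℚ K) h0
    have e1 : (16785 : K) * θ = (16785 : ℚ) • θ := by simp [Algebra.smul_def]
    have e2 : α ^ 2 - 7227 * α - 1750 = α ^ 2 - (7227 : ℚ) • α - (1750 : ℚ) • (1 : K) := by
      simp [Algebra.smul_def]
    rw [e1, e2, map_smul, map_sub, map_sub, map_smul, map_smul, t0, t1, t2] at h
    simp only [smul_eq_mul] at h
    linarith
  let A : 𝓞 K := ⟨α, hα⟩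
  let T : 𝓞 K := ⟨θ, hθi⟩
  have M0 : A * A = (1750 : ℤ) • 1 + (7227 : ℤ) • A + (16785 : ℤ) • T := by
    apply RingOfIntegers.ext
    simp only [zsmul_eq_mul, map_add, map_mul, map_one, map_intCast]
    change α * α = ((1750 : ℤ) : K) * 1 + ((7227 : ℤ) : K) * α + ((16785 : ℤ) : K) * θ
    push_cast
    linear_combination -h0
  have M1 : A * T = (-1050 : ℤ) • 1 + (-2676 : ℤ) • A + (-6185 : ℤ) • T := by
    apply RingOfIntegers.ext
    simp only [zsmul_eq_mul, map_add, map_mul, map_one, map_intCast]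
    change α * θ = ((-1050 : ℤ) : K) * 1 + ((-2676 : ℤ) : K) * α + ((-6185 : ℤ) : K) * θ
    push_cast
    linear_combination m1
  have M2 : T * T = (560 : ℤ) • 1 + (986 : ℤ) • A + (2266 : ℤ) • T := by
    apply RingOfIntegers.ext
    simp only [zsmul_eq_mul, map_add, map_mul, map_one, map_intCast]
    change θ * θ = ((560 : ℤ) : K) * 1 + ((986 : ℤ) : K) * α + ((2266 : ℤ) : K) * θ
    push_cast
    linear_combination m2
  have T0 : Algebra.trace ℤ (𝓞 K) 1 = 3 := by
    have h : ((Algebra.trace ℤ (𝓞 K) 1 : ℤ) : ℚ) = 3 := (Algebra.coe_trace_int 1).trans t0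
    exact_mod_cast h
  have T1 : Algebra.trace ℤ (𝓞 K) A = 1042 := by
    have h : ((Algebra.trace ℤ (𝓞 K) A : ℤ) : ℚ) = 1042 := (Algebra.coe_trace_int A).trans t1
    exact_mod_cast h
  have T2 : Algebra.trace ℤ (𝓞 K) T = -410 := by
    have h : ((Algebra.trace ℤ (𝓞 K) T : ℤ) : ℚ) = -410 := (Algebra.coe_trace_int T).trans t3
    exact_mod_cast h
  have T3 : Algebra.trace ℤ (𝓞 K) (A * A) = 653934 := by
    rw [M0]
    simp only [map_add, map_smul, T0, T1, T2, smul_eq_mul]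
    norm_num
  have T4 : Algebra.trace ℤ (𝓞 K) (A * T) = -255692 := by
    rw [M1]
    simp only [map_add, map_smul, T0, T1, T2, smul_eq_mul]
    norm_num
  have T5 : Algebra.trace ℤ (𝓞 K) (T * T) = 100032 := by
    rw [M2]
    simp only [map_add, map_smul, T0, T1, T2, smul_eq_mul]
    norm_num
  let r : Fin 3 → 𝓞 K := ![1, A, T]
  have hdr : Algebra.discr ℤ r = 43803704 := by
    rw [Algebra.discr_def, Matrix.det_fin_three]
    simp only [Algebra.traceMatrix_apply, Algebra.traceForm_apply, r, Matrix.cons_val,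
      mul_comm T A, mul_one, one_mul, T0, T1, T2, T3, T4, T5]
    norm_num
  let B : Basis (Fin 3) ℤ (𝓞 K) :=
    (RingOfIntegers.basis K).reindex
      (Basis.indexEquiv ((RingOfIntegers.basis K).localizationLocalization ℚ (nonZeroDivisors ℤ) K)
        b)
  have hB : Algebra.discr ℤ B = discr K := discr_eq_discr K B
  set P := B.toMatrix r with hP
  have hPr : Matrix.vecMul (B : Fin 3 → 𝓞 K) (P.map (algebraMap ℤ (𝓞 K))) = r := B.toMatrix_map_vecMul r
  have hdet : P.det ^ 2 * discr K = 43803704 := by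
    rw [← hB, ← Algebra.discr_of_matrix_vecMul, hPr, hdr]
  rcases sq_dvd_aux _ _ hdet with h1 | h2
  · rw [h1, one_mul] at hdet
    exact hdet
  exfalso
  have hdet2 : (P.map (Int.castRingHom (ZMod 2))).det = 0 := by
    rw [← RingHom.mapMatrix_apply, ← RingHom.map_det]
    exact (ZMod.intCast_zmod_eq_zero_iff_dvd _ 2).mpr h2
  obtain ⟨v, hv0, hv⟩ := Matrix.exists_mulVec_eq_zero_iff.mpr hdet2
  let w : Fin 3 → ℤ := fun i => ((v i).val : ℤ)
  have hwv : ∀ i, ((w i : ℤ) : ZMod 2) = v i := fun i => by simp [w]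
  have hw01 : ∀ i, w i = 0 ∨ w i = 1 := fun i => by
    have := ZMod.val_lt (v i)
    simp only [w]
    omega
  have hw0 : ¬ (w 0 = 0 ∧ w 1 = 0 ∧ w 2 = 0) := by
    rintro ⟨h0, h1, h2⟩
    apply hv0
    ext i
    rw [← hwv i]
    fin_cases i <;> simp [h0, h1, h2]
  have hdiv : ∀ i, ∃ y : ℤ, (P.mulVec w) i = 2 * y := fun i => by
    have h := congrFun hv i
    apply (ZMod.intCast_zmod_eq_zero_iff_dvd _ 2).mp
    simp only [Matrix.mulVec, dotProduct, Matrix.map_apply, Pi.zero_apply] at h ⊢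
    push_cast
    simp only [hwv]
    exact h
  choose y hy using hdiv
  obtain ⟨x, hx⟩ : ∃ x : 𝓞 K, w 0 • (1 : 𝓞 K) + w 1 • A + w 2 • T = (2 : ℤ) • x := by
    refine ⟨∑ i, y i • B i, ?_⟩
    have e : ∀ j, r j = ∑ i, P i j • B i := fun j => (B.sum_toMatrix_smul_self r j).symm
    have e0 : (1 : 𝓞 K) = ∑ i, P i 0 • B i := e 0
    have e1 : A = ∑ i, P i 1 • B i := e 1
    have e2 : T = ∑ i, P i 2 • B i := e 2
    rw [e1, e2]
    nth_rewrite 1 [e0]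
    simp only [Matrix.mulVec, dotProduct, Fin.sum_univ_three] at hy ⊢
    have y0 := congrArg (fun z : ℤ => z • B 0) (hy 0)
    have y1 := congrArg (fun z : ℤ => z • B 1) (hy 1)
    have y2 := congrArg (fun z : ℤ => z • B 2) (hy 2)
    simp only [zsmul_eq_mul] at y0 y1 y2 ⊢
    push_cast at y0 y1 y2 ⊢
    linear_combination y0 + y1 + y2
  obtain ⟨s, hs⟩ := trace_sq_aux (𝓞 K) B x
  have q1 : w 0 * 3 + w 1 * 1042 + w 2 * (-410) = 2 * Algebra.trace ℤ (𝓞 K) x := by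
    have := congrArg (Algebra.trace ℤ (𝓞 K)) hx
    simpa only [map_add, map_smul, T0, T1, T2, smul_eq_mul] using this
  have q2 : w 0 ^ 2 * 3 + w 1 ^ 2 * 653934 + w 2 ^ 2 * 100032 + 2 * w 0 * w 1 * 1042
      - 2 * w 0 * w 2 * 410 - 2 * w 1 * w 2 * 255692 = 4 * Algebra.trace ℤ (𝓞 K) (x * x) := by
    have h4 : (w 0 ^ 2) • (1 : 𝓞 K) + (w 1 ^ 2) • (A * A) + (w 2 ^ 2) • (T * T)
        + (2 * w 0 * w 1) • A + (2 * w 0 * w 2) • T + (2 * w 1 * w 2) • (A * T)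
        = (4 : ℤ) • (x * x) := by
      simp only [zsmul_eq_mul] at hx ⊢
      push_cast at hx ⊢
      linear_combination (w 0 + w 1 * A + w 2 * T + 2 * x) * hx
    have := congrArg (Algebra.trace ℤ (𝓞 K)) h4
    simp only [map_add, map_smul, T0, T1, T2, T3, T4, T5, smul_eq_mul] at this
    linarith
  generalize Algebra.trace ℤ (𝓞 K) x = a at *
  generalize Algebra.trace ℤ (𝓞 K) (x * x) = c at *
  rcases hw01 0 with u0 | u0 <;> rcases hw01 1 with u1 | u1 <;> rcases hw01 2 with u2 | u2 <;>
    rw [u0, u1, u2] at q1 q2 hw0 <;> norm_num at q1 q2 hw0 <;> first | omega | skip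
  all_goals
    have ha : a = -205 ∨ a = 316 ∨ a = 521 := by omega
    rcases ha with rfl | rfl | rfl <;> omega
end
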